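/- arXiv:2506.12979 — 5 statements merged into one kernel-verified Lean document; each statement's English description precedes it below -/
import Mathlib

section
/- Let X = [a, b] ⊂ ℝ be a compact interval and Δ(X) the set of Borel probability measures on X with the weak* topology. Let Θ = [θ̲, θ̄] ⊂ ℝ, let u : ℝ → ℝ be strictly increasing, continuous and weakly concave, and let C : Θ × Δ(X) → ℝ be weak*-continuous in its second argument and FOSD-monotone in its second argument for every θ (if μ' first-order stochastically dominates μ then C(θ, μ') ≥ C(θ, μ)). Let {w_θ, μ_θ}_{θ∈Θ} be an incentive compatible mechanism, i.e. each w_θ : X → ℝ is measurable and bounded above, each μ_θ ∈ Δ(X), u∘w_{θ̂} is μ-integrable for all relevant pairs, and for all θ, θ̂ ∈ Θ and all μ' ∈ Δ(X): ∫ u(w_θ(x)) μ_θ(dx) − C(θ, μ_θ) ≥ ∫ u(w_{θ̂}(x)) μ'(dx) − C(θ, μ'). For each θ define w̄_θ(x) = lim_{ε↘0} sup_{y ≤ x+ε} w_θ(y) for x < b and w̄_θ(b) = sup_{y ≤ b} w_θ(y). Then each w̄_θ is non-decreasing and right-continuous, the mechanism {w̄_θ, μ_θ}_{θ∈Θ}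 is incentive compatible, and for every θ ∈ Θ: μ_θ({x ∈ X : w̄_θ(x) ≠ w_θ(x)}) = 0. -/
open MeasureTheory

/-- The monotone envelope `w̃(x) = sup_{y ≤ x} w(y)` of a wage `w` on `X = [a,b]`. -/
noncomputable def monotoneEnvelope {a b : ℝ} (w : (Set.Icc a b) → ℝ) (x : Set.Icc a b) : ℝ :=
  sSup (w '' {y | y ≤ x})

/-- The wage `w̄(x) = lim_{ε ↘ 0} sup_{y ≤ x+ε} w(y) = inf_{y > x} w̃(y)` for `x < b`
and `w̄(b) = sup_{y ≤ b} w(y)`, the non-decreasing right-continuous modification of `w`. -/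
noncomputable def rcEnvelope {a b : ℝ} (w : (Set.Icc a b) → ℝ) (x : Set.Icc a b) : ℝ :=
  if (x : ℝ) < b then sInf (monotoneEnvelope w '' {y | x < y}) else monotoneEnvelope w x

/-- `μ'` first-order stochastically dominates `μ`: every bounded non-decreasing
measurable function has a larger integral under `μ'`. -/
def FOSDdom {a b : ℝ} (μ μ' : ProbabilityMeasure (Set.Icc a b)) : Prop :=
  ∀ f : (Set.Icc a b) → ℝ, Measurable f → Monotone f → (∃ M, ∀ x, |f x| ≤ M) →
    (∫ x, f x ∂(μ : Measure (Set.Icc a b))) ≤ ∫ x, f x ∂(μ' : Measure (Set.Icc a b))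


section helpers
open Filter Topology

variable {a b : ℝ} {w : (Set.Icc a b) → ℝ}

lemma mwl_bdd (hw : BddAbove (Set.range w)) (x : Set.Icc a b) :
    BddAbove (w '' {y | y ≤ x}) := hw.mono (Set.image_subset_range _ _)

lemma mwl_le_env (hw : BddAbove (Set.range w)) {y x : Set.Icc a b} (h : y ≤ x) :
    w y ≤ monotoneEnvelope w x := le_csSup (mwl_bdd hw x) ⟨y, h, rfl⟩

lemma mwl_env_mono (hw : BddAbove (Set.range w)) : Monotone (monotoneEnvelope w) := by
  intro x z h
  refine csSup_le_csSup (mwl_bdd hw z) ⟨w x, x, le_refl x, rfl⟩ ?_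
  exact Set.image_mono fun y hy => le_trans hy h

lemma mwl_bddBelow (hw : BddAbove (Set.range w)) (x : Set.Icc a b) :
    BddBelow (monotoneEnvelope w '' {y | x < y}) := by
  refine ⟨monotoneEnvelope w x, ?_⟩
  rintro _ ⟨y, hy, rfl⟩
  exact mwl_env_mono hw (le_of_lt hy)

lemma mwl_rc_le (hw : BddAbove (Set.range w)) {x y : Set.Icc a b} (h : x < y) :
    rcEnvelope w x ≤ monotoneEnvelope w y := by
  have hx : (x : ℝ) < b := lt_of_lt_of_le h y.2.2
  rw [rcEnvelope, if_pos hx]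
  exact csInf_le (mwl_bddBelow hw x) ⟨y, h, rfl⟩

lemma mwl_env_le_rc (hw : BddAbove (Set.range w)) (x : Set.Icc a b) :
    monotoneEnvelope w x ≤ rcEnvelope w x := by
  rw [rcEnvelope]
  split_ifs with hx
  · refine le_csInf ⟨_, ⟨b, x.2.1.trans x.2.2, le_refl b⟩, hx, rfl⟩ ?_
    rintro _ ⟨y, hy, rfl⟩
    exact mwl_env_mono hw (le_of_lt hy)
  · exact le_refl _

lemma mwl_rc_mono (hw : BddAbove (Set.range w)) : Monotone (rcEnvelope w) := by
  intro x z h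
  rcases h.lt_or_eq with h | h
  · exact (mwl_rc_le hw h).trans (mwl_env_le_rc hw z)
  · rw [h]

lemma mwl_rc_cont (hw : BddAbove (Set.range w)) (x : Set.Icc a b) :
    ContinuousWithinAt (rcEnvelope w) (Set.Ici x) x := by
  refine tendsto_order.2 ⟨fun c hc => ?_, fun c hc => ?_⟩
  · filter_upwards [self_mem_nhdsWithin] with z hz
    exact lt_of_lt_of_le hc (mwl_rc_mono hw hz)
  · by_cases hx : (x : ℝ) < b
    · have hc' := hc
      rw [rcEnvelope, if_pos hx] at hc'
      obtain ⟨_, ⟨y, hy, rfl⟩, hyc⟩ :=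
        exists_lt_of_csInf_lt (Set.Nonempty.image _
          ⟨(⟨b, x.2.1.trans x.2.2, le_refl b⟩ : Set.Icc a b), hx⟩) hc'
      filter_upwards [mem_nhdsWithin_of_mem_nhds (Iio_mem_nhds hy)] with z hz
      exact lt_of_le_of_lt (mwl_rc_le hw hz) hyc
    · filter_upwards [self_mem_nhdsWithin] with z hz
      have : z = x := by
        apply le_antisymm _ hz
        exact z.2.2.trans (not_lt.1 hx)
      rwa [this]

/-- discretisation -/
noncomputable def mwlG (a b : ℝ) (hab : a ≤ b) (n : ℕ) (k : ℤ) : Set.Icc a b :=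
  ⟨max a (min b (((k : ℝ) + 1) / ((n : ℝ) + 1))), le_max_left _ _,
    max_le hab (min_le_left _ _)⟩

noncomputable def mwlF {a b : ℝ} (n : ℕ) (x : Set.Icc a b) : ℤ := ⌊(x : ℝ) * ((n : ℝ) + 1)⌋

lemma mwlF_meas (n : ℕ) : Measurable (mwlF n : Set.Icc a b → ℤ) := by
  unfold mwlF
  exact Int.measurable_floor.comp (measurable_subtype_coe.mul_const _)

lemma mwl_T_gt (hab : a ≤ b) (n : ℕ) (x : Set.Icc a b) (hx : (x : ℝ) < b) :
    x < mwlG a b hab n (mwlF n x) := by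
  have hn : (0 : ℝ) < (n : ℝ) + 1 := by positivity
  have h : (x : ℝ) < ((mwlF n x : ℝ) + 1) / ((n : ℝ) + 1) := by
    rw [lt_div_iff₀ hn]; exact Int.lt_floor_add_one _
  show (x : ℝ) < max a (min b _)
  exact lt_max_of_lt_right (lt_min hx h)

lemma mwl_T_le (hab : a ≤ b) (n : ℕ) (x : Set.Icc a b) :
    (mwlG a b hab n (mwlF n x) : ℝ) ≤ x + 1 / ((n : ℝ) + 1) := by
  have hn : (0 : ℝ) < (n : ℝ) + 1 := by positivity
  have h : ((mwlF n x : ℝ) + 1) / ((n : ℝ) + 1) ≤ x + 1 / ((n : ℝ) + 1) := by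
    rw [add_div]
    gcongr
    rw [div_le_iff₀ hn]; exact Int.floor_le _
  have : (0 : ℝ) < 1 / ((n : ℝ) + 1) := by positivity
  show max a (min b _) ≤ _
  exact max_le (by linarith [x.2.1]) ((min_le_right _ _).trans h)

lemma mwl_T_ge (hab : a ≤ b) (n : ℕ) (x : Set.Icc a b) :
    x ≤ mwlG a b hab n (mwlF n x) := by
  by_cases hx : (x : ℝ) < b
  · exact (mwl_T_gt hab n x hx).le
  · have hn : (0 : ℝ) < (n : ℝ) + 1 := by positivity
    have h : (x : ℝ) < ((mwlF n x : ℝ) + 1) / ((n : ℝ) + 1) := by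
      rw [lt_div_iff₀ hn]; exact Int.lt_floor_add_one _
    show (x : ℝ) ≤ max a (min b _)
    exact le_max_of_le_right (le_min x.2.2 h.le)

lemma mwl_rc_le_T (hw : BddAbove (Set.range w)) (hab : a ≤ b) (n : ℕ) (x : Set.Icc a b) :
    rcEnvelope w x ≤ monotoneEnvelope w (mwlG a b hab n (mwlF n x)) := by
  by_cases hx : (x : ℝ) < b
  · exact mwl_rc_le hw (mwl_T_gt hab n x hx)
  · rw [rcEnvelope, if_neg hx]
    exact mwl_env_mono hw (mwl_T_ge hab n x)

lemma mwl_T_meas (hab : a ≤ b) (n : ℕ) :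
    Measurable (fun x : Set.Icc a b => mwlG a b hab n (mwlF n x)) :=
  (measurable_from_top (f := mwlG a b hab n)).comp (mwlF_meas n)

lemma mwl_T_tendsto (hab : a ≤ b) (x : Set.Icc a b) :
    Tendsto (fun n => mwlG a b hab n (mwlF n x)) atTop (𝓝 x) := by
  rw [tendsto_subtype_rng]
  have h1 : Tendsto (fun n : ℕ => (x : ℝ) + 1 / ((n : ℝ) + 1)) atTop (𝓝 (x : ℝ)) := by
    simpa using tendsto_const_nhds.add (tendsto_one_div_add_atTop_nhds_zero_nat (𝕜 := ℝ))
  exact tendsto_of_tendsto_of_tendsto_of_le_of_le tendsto_const_nhds h1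
    (fun n => mwl_T_ge hab n x) (fun n => mwl_T_le hab n x)

lemma mwl_map_tendsto (hab : a ≤ b) (μ : ProbabilityMeasure (Set.Icc a b)) :
    Tendsto (fun n => μ.map (mwl_T_meas hab n).aemeasurable) atTop (𝓝 μ) := by
  rw [ProbabilityMeasure.tendsto_iff_forall_integral_tendsto]
  intro f
  have : ∀ n, ∫ x, f x ∂((μ.map (mwl_T_meas hab n).aemeasurable :
      ProbabilityMeasure (Set.Icc a b)) : Measure (Set.Icc a b))
      = ∫ x, f (mwlG a b hab n (mwlF n x)) ∂(μ : Measure (Set.Icc a b)) := by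
    intro n
    rw [ProbabilityMeasure.toMeasure_map]
    exact integral_map (mwl_T_meas hab n).aemeasurable
      f.continuous.measurable.aestronglyMeasurable
  simp_rw [this]
  refine tendsto_integral_of_dominated_convergence (fun _ => ‖f‖) ?_ (integrable_const _) ?_ ?_
  · intro n
    exact (f.continuous.measurable.comp (mwl_T_meas hab n)).aestronglyMeasurable
  · intro n
    exact Eventually.of_forall fun x => f.norm_coe_le_norm _
  · exact Eventually.of_forall fun x => (f.continuous.tendsto x).comp (mwl_T_tendsto hab x)

lemma mwl_mono_int (hab : a ≤ b) {f : Set.Icc a b → ℝ} (hf : Monotone f)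
    (μ : ProbabilityMeasure (Set.Icc a b)) : Integrable f (μ : Measure (Set.Icc a b)) := by
  refine Integrable.of_mem_Icc (f ⟨a, le_refl a, hab⟩) (f ⟨b, hab, le_refl b⟩)
    hf.measurable.aemeasurable (Eventually.of_forall fun x => ⟨hf x.2.1, hf x.2.2⟩)

lemma mwl_key (hab : a ≤ b) (hw : BddAbove (Set.range w)) (hwm : Measurable w)
    {u : ℝ → ℝ} (hu_mono : StrictMono u) (hu_cont : Continuous u)
    (hint : ∀ μ' : ProbabilityMeasure (Set.Icc a b),
      Integrable (fun x => u (w x)) (μ' : Measure (Set.Icc a b)))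
    {C : ProbabilityMeasure (Set.Icc a b) → ℝ} (hC : Continuous C)
    (hF : ∀ μ μ' : ProbabilityMeasure (Set.Icc a b), FOSDdom μ μ' → C μ ≤ C μ')
    {V : ℝ} (hV : ∀ μ' : ProbabilityMeasure (Set.Icc a b),
      (∫ x, u (w x) ∂(μ' : Measure (Set.Icc a b))) - C μ' ≤ V)
    (μ : ProbabilityMeasure (Set.Icc a b)) :
    (∫ x, u (rcEnvelope w x) ∂(μ : Measure (Set.Icc a b))) - C μ ≤ V := by
  refine le_of_forall_pos_le_add fun δ hδ => ?_
  have hs : ∀ t : Set.Icc a b, ∃ y ≤ t, u (monotoneEnvelope w t) - δ < u (w y) := by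
    intro t
    have h1 : ∀ᶠ z in 𝓝 (monotoneEnvelope w t), u (monotoneEnvelope w t) - δ < u z :=
      (hu_cont.tendsto _).eventually (lt_mem_nhds (by linarith))
    obtain ⟨l, hl, hl2⟩ := exists_Ioc_subset_of_mem_nhds h1 ⟨_, sub_one_lt _⟩
    obtain ⟨_, ⟨y, hy, rfl⟩, hyl⟩ := exists_lt_of_lt_csSup
      (Set.Nonempty.image w ⟨t, le_refl t⟩ : (w '' {y | y ≤ t}).Nonempty) hl
    exact ⟨y, hy, hl2 ⟨hyl, mwl_le_env hw hy⟩⟩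
  choose s hs1 hs2 using hs
  have hlim := (hC.tendsto μ).comp (mwl_map_tendsto hab μ)
  have hlim2 : Tendsto (fun n => (∫ x, u (rcEnvelope w x) ∂(μ : Measure (Set.Icc a b)))
      - C (μ.map (mwl_T_meas hab n).aemeasurable)) atTop
      (𝓝 ((∫ x, u (rcEnvelope w x) ∂(μ : Measure (Set.Icc a b))) - C μ)) :=
    tendsto_const_nhds.sub hlim
  refine le_of_tendsto' hlim2 fun n => ?_
  have hym : Measurable (fun x : Set.Icc a b => s (mwlG a b hab n (mwlF n x))) :=
    (measurable_from_top (f := fun k => s (mwlG a b hab n k))).comp (mwlF_meas n)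
  have hdom : FOSDdom (μ.map hym.aemeasurable) (μ.map (mwl_T_meas hab n).aemeasurable) := by
    intro f hfm hf _
    have hmm : ∀ t, f ⟨a, le_refl a, hab⟩ ≤ f t := fun t => hf t.2.1
    have hMM : ∀ t, f t ≤ f ⟨b, hab, le_refl b⟩ := fun t => hf t.2.2
    rw [ProbabilityMeasure.toMeasure_map, ProbabilityMeasure.toMeasure_map,
      integral_map hym.aemeasurable hfm.aestronglyMeasurable,
      integral_map (mwl_T_meas hab n).aemeasurable hfm.aestronglyMeasurable]
    refine integral_mono ?_ ?_ fun x => hf (hs1 _)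
    · exact Integrable.of_mem_Icc (f ⟨a, le_refl a, hab⟩) (f ⟨b, hab, le_refl b⟩)
        (hfm.comp hym).aemeasurable (Eventually.of_forall fun x => ⟨hmm _, hMM _⟩)
    · exact Integrable.of_mem_Icc (f ⟨a, le_refl a, hab⟩) (f ⟨b, hab, le_refl b⟩)
        (hfm.comp (mwl_T_meas hab n)).aemeasurable
        (Eventually.of_forall fun x => ⟨hmm _, hMM _⟩)
  have h1 := hF _ _ hdom
  have h2 := hV (μ.map hym.aemeasurable)
  have h3 := hint (μ.map hym.aemeasurable)
  have huw : Measurable (fun x => u (w x)) := hu_cont.measurable.comp hwm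
  rw [ProbabilityMeasure.toMeasure_map] at h2 h3
  rw [integral_map hym.aemeasurable huw.aestronglyMeasurable] at h2
  have h3' : Integrable (fun x => u (w (s (mwlG a b hab n (mwlF n x)))))
      (μ : Measure (Set.Icc a b)) := h3.comp_measurable hym
  have h4 : ∫ x, u (rcEnvelope w x) ∂(μ : Measure (Set.Icc a b)) ≤
      ∫ x, (u (w (s (mwlG a b hab n (mwlF n x)))) + δ) ∂(μ : Measure (Set.Icc a b)) := by
    refine integral_mono (mwl_mono_int hab (hu_mono.monotone.comp (mwl_rc_mono hw)) μ)
      (h3'.add (integrable_const δ)) fun x => ?_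
    have e1 := hu_mono.monotone (mwl_rc_le_T hw hab n x)
    have e2 := hs2 (mwlG a b hab n (mwlF n x))
    show u (rcEnvelope w x) ≤ u (w (s (mwlG a b hab n (mwlF n x)))) + δ
    linarith
  rw [integral_add h3' (integrable_const δ)] at h4
  simp only [integral_const, probReal_univ, smul_eq_mul, one_mul] at h4
  linarith

end helpers

/-- Lemma 1 of the paper: Given an incentive compatible mechanism
`{w_θ, μ_θ}_{θ∈Θ}` (wages measurable and bounded above, `u∘w_{θ̂}` integrable, and
`U(θ, w_θ, μ_θ) ≥ U(θ, w_{θ̂}, μ')` for all `θ, θ̂ ∈ Θ` and `μ' ∈ Δ(X)`), the wages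
`w̄_θ(x) = lim_{ε↘0} sup_{y ≤ x+ε} w_θ(y)` (with `w̄_θ(b) = sup_{y ≤ b} w_θ(y)`) are
non-decreasing and right-continuous, the mechanism `{w̄_θ, μ_θ}` is incentive
compatible, and `μ_θ({x : w̄_θ(x) ≠ w_θ(x)}) = 0` for every `θ ∈ Θ`. -/
theorem monotone_wages_wlog (a b θlo θhi : ℝ) (hab : a ≤ b)
    (u : ℝ → ℝ) (hu_mono : StrictMono u) (hu_cont : Continuous u)
    (hu_conc : ConcaveOn ℝ Set.univ u)
    (C : ℝ → ProbabilityMeasure (Set.Icc a b) → ℝ)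
    (hC_cont : ∀ θ ∈ Set.Icc θlo θhi, Continuous (C θ))
    (hC_fosd : ∀ θ ∈ Set.Icc θlo θhi, ∀ μ μ' : ProbabilityMeasure (Set.Icc a b),
      FOSDdom μ μ' → C θ μ ≤ C θ μ')
    (w : ℝ → (Set.Icc a b) → ℝ) (μm : ℝ → ProbabilityMeasure (Set.Icc a b))
    (hw_meas : ∀ θ ∈ Set.Icc θlo θhi, Measurable (w θ))
    (hw_bdd : ∀ θ ∈ Set.Icc θlo θhi, BddAbove (Set.range (w θ)))
    (hint : ∀ θhat ∈ Set.Icc θlo θhi, ∀ μ' : ProbabilityMeasure (Set.Icc a b),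
      Integrable (fun x => u (w θhat x)) (μ' : Measure (Set.Icc a b)))
    (hIC : ∀ θ ∈ Set.Icc θlo θhi, ∀ θhat ∈ Set.Icc θlo θhi,
      ∀ μ' : ProbabilityMeasure (Set.Icc a b),
      (∫ x, u (w θhat x) ∂(μ' : Measure (Set.Icc a b))) - C θ μ' ≤
        (∫ x, u (w θ x) ∂(μm θ : Measure (Set.Icc a b))) - C θ (μm θ)) :
    (∀ θ ∈ Set.Icc θlo θhi, Monotone (rcEnvelope (w θ))) ∧
    (∀ θ ∈ Set.Icc θlo θhi, ∀ x : Set.Icc a b,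
      ContinuousWithinAt (rcEnvelope (w θ)) (Set.Ici x) x) ∧
    (∀ θ ∈ Set.Icc θlo θhi, ∀ θhat ∈ Set.Icc θlo θhi,
      ∀ μ' : ProbabilityMeasure (Set.Icc a b),
      (∫ x, u (rcEnvelope (w θhat) x) ∂(μ' : Measure (Set.Icc a b))) - C θ μ' ≤
        (∫ x, u (rcEnvelope (w θ) x) ∂(μm θ : Measure (Set.Icc a b))) - C θ (μm θ)) ∧
    (∀ θ ∈ Set.Icc θlo θhi,
      (μm θ : Measure (Set.Icc a b)) {x | rcEnvelope (w θ) x ≠ w θ x} = 0) := by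
  have key : ∀ θ ∈ Set.Icc θlo θhi, ∀ θhat ∈ Set.Icc θlo θhi,
      ∀ μ' : ProbabilityMeasure (Set.Icc a b),
      (∫ x, u (rcEnvelope (w θhat) x) ∂(μ' : Measure (Set.Icc a b))) - C θ μ' ≤
        (∫ x, u (w θ x) ∂(μm θ : Measure (Set.Icc a b))) - C θ (μm θ) :=
    fun θ hθ θ' hθ' μ' => mwl_key hab (hw_bdd θ' hθ') (hw_meas θ' hθ') hu_mono hu_cont
      (hint θ' hθ') (hC_cont θ hθ) (hC_fosd θ hθ) (hIC θ hθ θ' hθ') μ'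
  have hle : ∀ θ ∈ Set.Icc θlo θhi, ∀ x, u (w θ x) ≤ u (rcEnvelope (w θ) x) :=
    fun θ hθ x => hu_mono.monotone ((mwl_le_env (hw_bdd θ hθ) (le_refl x)).trans
      (mwl_env_le_rc (hw_bdd θ hθ) x))
  have hrint : ∀ θ ∈ Set.Icc θlo θhi, Integrable (fun x => u (rcEnvelope (w θ) x))
      (μm θ : Measure (Set.Icc a b)) := fun θ hθ =>
    mwl_mono_int hab (hu_mono.monotone.comp (mwl_rc_mono (hw_bdd θ hθ))) _
  have hge : ∀ θ ∈ Set.Icc θlo θhi, ∫ x, u (w θ x) ∂(μm θ : Measure (Set.Icc a b)) ≤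
      ∫ x, u (rcEnvelope (w θ) x) ∂(μm θ : Measure (Set.Icc a b)) := fun θ hθ =>
    integral_mono (hint θ hθ _) (hrint θ hθ) (hle θ hθ)
  refine ⟨fun θ hθ => mwl_rc_mono (hw_bdd θ hθ), fun θ hθ => mwl_rc_cont (hw_bdd θ hθ), ?_, ?_⟩
  · intro θ hθ θ' hθ' μ'
    linarith [key θ hθ θ' hθ' μ', hge θ hθ]
  · intro θ hθ
    have heq : ∫ x, u (w θ x) ∂(μm θ : Measure (Set.Icc a b)) =
      ∫ x, u (rcEnvelope (w θ) x) ∂(μm θ : Measure (Set.Icc a b)) := by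
      apply le_antisymm (hge θ hθ)
      linarith [key θ hθ θ hθ (μm θ)]
    have := (integral_eq_iff_of_ae_le (hint θ hθ _) (hrint θ hθ)
      (Filter.Eventually.of_forall (hle θ hθ))).1 heq
    have h2 : ∀ᵐ x ∂(μm θ : Measure (Set.Icc a b)), rcEnvelope (w θ) x = w θ x := by
      filter_upwards [this] with x hx
      exact hu_mono.injective hx.symm
    exact h2
end

section
/- Let X = [a, b] ⊂ ℝ be a compact interval, let w : X → ℝ be measurable and bounded above, and define w̃(x) = sup_{y ≤ x} w(y). For every Borel probability measure ν on X and every ε > 0, there exists a measurable function g : X → X such that g(x) ≤ x for all x ∈ X and w(g(x)) ≥ w̃(x) − ε for ν-almost all x ∈ X. -/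
open MeasureTheory

theorem exists_countable_coinitial_aux {α : Type*} [LinearOrder α] [TopologicalSpace α]
    [OrderTopology α] [SecondCountableTopology α] (L : Set α) :
    ∃ D : Set α, D.Countable ∧ D ⊆ L ∧ ∀ y ∈ L, ∃ d ∈ D, d ≤ y := by
  obtain ⟨T, hTL, hTc, hT⟩ := TopologicalSpace.isOpen_biUnion_countable L
    (fun y => Set.Ioi y) (fun y _ => isOpen_Ioi)
  refine ⟨T ∪ {y | IsLeast L y}, hTc.union ?_, ?_, ?_⟩
  · exact Set.Subsingleton.countable (fun x hx y hy => IsLeast.unique hx hy)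
  · rintro y (hy | hy)
    · exact hTL hy
    · exact hy.1
  · intro y hy
    by_cases h : IsLeast L y
    · exact ⟨y, Or.inr h, le_rfl⟩
    · have : ∃ z ∈ L, z < y := by
        by_contra hc
        push Not at hc
        exact h ⟨hy, fun z hz => hc z hz⟩
      obtain ⟨z, hz, hzy⟩ := this
      have hm : y ∈ ⋃ i ∈ L, Set.Ioi i := Set.mem_biUnion hz hzy
      rw [← hT] at hm
      simp only [Set.mem_iUnion] at hm
      obtain ⟨d, hd, hdy⟩ := hm
      exact ⟨d, Or.inl hd, le_of_lt hdy⟩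

/-- Lemma 5 of GRS: For `w : [a,b] → ℝ` measurable and bounded above
with monotone envelope `w̃(x) = sup_{y ≤ x} w(y)`, for every Borel probability
measure `ν` on `[a,b]` and every `ε > 0` there is a measurable `g : X → X` with
`g(x) ≤ x` everywhere and `w(g(x)) ≥ w̃(x) − ε` for `ν`-almost all `x`. -/
theorem measurable_selection_envelope (a b : ℝ) (hab : a ≤ b)
    (w : (Set.Icc a b) → ℝ) (hw_meas : Measurable w) (hw_bdd : BddAbove (Set.range w))
    (ν : Measure (Set.Icc a b)) (hν : IsProbabilityMeasure ν)
    (ε : ℝ) (hε : 0 < ε) :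
    ∃ g : (Set.Icc a b) → (Set.Icc a b), Measurable g ∧ (∀ x, g x ≤ x) ∧
      ∀ᵐ x ∂ν, monotoneEnvelope w x - ε ≤ w (g x) := by
  classical
  have hbd : ∀ x, BddAbove (w '' {y | y ≤ x}) := fun x => hw_bdd.mono (Set.image_subset_range _ _)
  have hne : ∀ x, (w '' {y | y ≤ x}).Nonempty := fun x => ⟨w x, x, le_refl x, rfl⟩
  have hmono : Monotone (monotoneEnvelope w) := fun x y hxy =>
    csSup_le_csSup (hbd y) (hne x) (Set.image_mono (fun z hz => le_trans hz hxy))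
  have hmeas : Measurable (monotoneEnvelope w) := hmono.measurable
  choose D hDc hDL hD using fun q : ℚ => exists_countable_coinitial_aux {y | (q : ℝ) < w y}
  have key : ∀ x, ∃ d ∈ ⋃ q, D q, d ≤ x ∧ monotoneEnvelope w x - ε ≤ w d := by
    intro x
    obtain ⟨q, hq1, hq2⟩ := exists_rat_btwn (sub_lt_self (monotoneEnvelope w x) hε)
    obtain ⟨_, ⟨y, hy, rfl⟩, hqy⟩ := exists_lt_of_lt_csSup (hne x) hq2
    obtain ⟨d, hd, hdy⟩ := hD q y hqy
    have h1 : (q : ℝ) < w d := hDL q hd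
    exact ⟨d, Set.mem_iUnion.2 ⟨q, hd⟩, le_trans hdy hy, by linarith⟩
  obtain ⟨d0, hd0, -⟩ := key ⟨a, le_rfl, hab⟩
  obtain ⟨f, hf⟩ := (Set.countable_iUnion hDc).exists_eq_range ⟨d0, hd0⟩
  have key' : ∀ x, ∃ n : ℕ, f n ≤ x ∧ monotoneEnvelope w x - ε ≤ w (f n) := by
    intro x
    obtain ⟨d, hd, h⟩ := key x
    rw [hf] at hd
    obtain ⟨n, rfl⟩ := hd
    exact ⟨n, h⟩
  refine ⟨fun x => f (Nat.find (key' x)), ?_, fun x => (Nat.find_spec (key' x)).1,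
    Filter.Eventually.of_forall fun x => (Nat.find_spec (key' x)).2⟩
  refine Measurable.find (f := fun n _ => f n) (fun n => measurable_const) (fun n => ?_) key'
  exact (measurableSet_le measurable_const measurable_id).inter
    (measurableSet_le (hmeas.sub_const ε) measurable_const)
end

section
/- Let X = [a, b] ⊂ ℝ be a compact interval and Δ(X) the Borel probability measures on X with the weak* topology. Let w̃ : X → ℝ be non-decreasing and bounded above, and define its right-continuous modification w̄ by w̄(x) = lim_{ε↘0} w̃(x + ε) for x < b and w̄(b) = w̃(b). Let u : ℝ → ℝ be strictly increasing and continuous, and let C : Δ(X) → ℝ be weak*-continuous. Then sup_{μ ∈ Δ(X)} { ∫ u(w̄(x)) μ(dx) − C(μ) } = sup_{μ ∈ Δ(X)} { ∫ u(w̃(x)) μ(dx) − C(μ) }. Moreover, any μ* that attains the supremum for w̃ also attains the supremum for w̄, and μ*({x ∈ X : w̄(x) ≠ w̃(x)}) = 0. -/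
open MeasureTheory

/-- The right-continuous modification of a non-decreasing `w̃` on `X = [a,b]`:
`w̄(x) = lim_{ε ↘ 0} w̃(x+ε) = inf_{y > x} w̃(y)` for `x < b`, and `w̄(b) = w̃(b)`. -/
noncomputable def rcModification {a b : ℝ} (wt : (Set.Icc a b) → ℝ) (x : Set.Icc a b) : ℝ :=
  if (x : ℝ) < b then sInf (wt '' {y | x < y}) else wt x

section helpers
variable {a b : ℝ}

lemma rc_aux_bdd (hab : a ≤ b) {wt : (Set.Icc a b) → ℝ} (h : Monotone wt) (s : Set (Set.Icc a b)) :
    BddBelow (wt '' s) := by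
  refine ⟨wt ⟨a, le_rfl, hab⟩, ?_⟩
  rintro _ ⟨y, -, rfl⟩
  exact h y.2.1

lemma rc_aux_le (hab : a ≤ b) {wt : (Set.Icc a b) → ℝ} (h : Monotone wt) {x y : Set.Icc a b}
    (hxy : x < y) : rcModification wt x ≤ wt y := by
  have hx : (x : ℝ) < b := lt_of_lt_of_le hxy y.2.2
  rw [rcModification, if_pos hx]
  exact csInf_le (rc_aux_bdd hab h _) ⟨y, hxy, rfl⟩

lemma rc_aux_ge {wt : (Set.Icc a b) → ℝ} (h : Monotone wt) (x : Set.Icc a b) :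
    wt x ≤ rcModification wt x := by
  rw [rcModification]
  split_ifs with hx
  · apply le_csInf
    · exact ⟨_, ⟨b, x.2.1.trans x.2.2, le_rfl⟩, hx, rfl⟩
    · rintro _ ⟨y, hy, rfl⟩
      exact h (le_of_lt hy)
  · exact le_rfl

lemma rc_aux_mono (hab : a ≤ b) {wt : (Set.Icc a b) → ℝ} (h : Monotone wt) :
    Monotone (rcModification wt) := by
  intro x y hxy
  rcases hxy.eq_or_lt with rfl | hlt
  · exact le_rfl
  · exact (rc_aux_le hab h hlt).trans (rc_aux_ge h y)

lemma rc_aux_int (hab : a ≤ b) {f : (Set.Icc a b) → ℝ} (h : Monotone f)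
    (μ : ProbabilityMeasure (Set.Icc a b)) : Integrable f (μ : Measure (Set.Icc a b)) := by
  refine Integrable.of_bound h.measurable.aestronglyMeasurable
    (max |f ⟨a, le_rfl, hab⟩| |f ⟨b, hab, le_rfl⟩|) (Filter.Eventually.of_forall fun x => ?_)
  rw [Real.norm_eq_abs]
  exact abs_le_max_abs_abs (h x.2.1) (h x.2.2)

noncomputable def rcShift (hab : a ≤ b) (n : ℕ) (x : Set.Icc a b) : Set.Icc a b :=
  Set.projIcc a b hab ((x : ℝ) + 1 / ((n : ℝ) + 1))

lemma rcShift_cont (hab : a ≤ b) (n : ℕ) : Continuous (rcShift hab n) := by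
  unfold rcShift
  exact continuous_projIcc.comp (by fun_prop)

lemma rcShift_tendsto (hab : a ≤ b) (x : Set.Icc a b) :
    Filter.Tendsto (fun n => rcShift hab n x) Filter.atTop (nhds x) := by
  have h1 : Filter.Tendsto (fun n : ℕ => (x : ℝ) + 1 / ((n : ℝ) + 1)) Filter.atTop
      (nhds ((x : ℝ) + 0)) :=
    tendsto_const_nhds.add tendsto_one_div_add_atTop_nhds_zero_nat
  have h2 := ((continuous_projIcc (h := hab)).tendsto ((x : ℝ) + 0)).comp h1
  rw [add_zero, Set.projIcc_val] at h2
  exact h2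

lemma rcShift_le (hab : a ≤ b) {wt : (Set.Icc a b) → ℝ} (h : Monotone wt) (n : ℕ)
    (x : Set.Icc a b) : rcModification wt x ≤ wt (rcShift hab n x) := by
  have hp : (0 : ℝ) < 1 / ((n : ℝ) + 1) := by positivity
  by_cases hx : (x : ℝ) < b
  · apply rc_aux_le hab h
    rw [← Subtype.coe_lt_coe, rcShift, Set.coe_projIcc]
    exact lt_max_of_lt_right (lt_min hx (by linarith))
  · rw [rcModification, if_neg hx]
    apply h
    rw [← Subtype.coe_le_coe, rcShift, Set.coe_projIcc]
    exact le_max_of_le_right (le_min x.2.2 (by linarith))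

lemma rc_aux_key (hab : a ≤ b) {wt : (Set.Icc a b) → ℝ} (h : Monotone wt)
    {u : ℝ → ℝ} (hu : Monotone u)
    {C : ProbabilityMeasure (Set.Icc a b) → ℝ} (hC : Continuous C) (K : ℝ)
    (hK : ∀ ν : ProbabilityMeasure (Set.Icc a b),
        (∫ x, u (wt x) ∂(ν : Measure (Set.Icc a b))) - C ν ≤ K)
    (μ : ProbabilityMeasure (Set.Icc a b)) :
    (∫ x, u (rcModification wt x) ∂(μ : Measure (Set.Icc a b))) - C μ ≤ K := by
  let ν : ℕ → ProbabilityMeasure (Set.Icc a b) := fun n =>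
    μ.map (rcShift_cont hab n).measurable.aemeasurable
  have hν : Filter.Tendsto ν Filter.atTop (nhds μ) := by
    rw [ProbabilityMeasure.tendsto_iff_forall_integral_tendsto]
    intro f
    have e : ∀ n, ∫ x, f x ∂(ν n : Measure (Set.Icc a b))
        = ∫ x, f (rcShift hab n x) ∂(μ : Measure (Set.Icc a b)) := fun n =>
      integral_map (rcShift_cont hab n).measurable.aemeasurable
        f.continuous.measurable.aestronglyMeasurable
    simp_rw [e]
    refine tendsto_integral_of_dominated_convergence (fun _ => ‖f‖) ?_ (integrable_const _) ?_ ?_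
    · intro n
      exact (f.continuous.comp (rcShift_cont hab n)).measurable.aestronglyMeasurable
    · intro n
      exact Filter.Eventually.of_forall fun x => f.norm_coe_le_norm _
    · exact Filter.Eventually.of_forall fun x =>
        (f.continuous.tendsto x).comp (rcShift_tendsto hab x)
  have hl := (tendsto_const_nhds
    (x := ∫ x, u (rcModification wt x) ∂(μ : Measure (Set.Icc a b)))).sub ((hC.tendsto μ).comp hν)
  refine le_of_tendsto hl (Filter.Eventually.of_forall fun n => ?_)
  refine le_trans ?_ (hK (ν n))
  have e : ∫ x, u (wt x) ∂(ν n : Measure (Set.Icc a b))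
      = ∫ x, u (wt (rcShift hab n x)) ∂(μ : Measure (Set.Icc a b)) :=
    integral_map (rcShift_cont hab n).measurable.aemeasurable
      (hu.comp h).measurable.aestronglyMeasurable
  have hm : Monotone (rcShift hab n) := by
    intro x y hxy
    refine Set.monotone_projIcc hab ?_
    have : (x : ℝ) ≤ y := hxy
    linarith
  rw [e]
  refine sub_le_sub_right ?_ _
  exact integral_mono (rc_aux_int hab (hu.comp (rc_aux_mono hab h)) μ)
    (rc_aux_int hab ((hu.comp h).comp hm) μ) (fun x => hu (rcShift_le hab h n x))

end helpers

/-- Passing from a non-decreasing wage `w̃` (bounded above) to its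
right-continuous modification `w̄` leaves the agent's value
`sup_{μ ∈ Δ(X)} {∫ u∘w̃ dμ − C(μ)}` unchanged when `u` is strictly increasing and
continuous and `C` is weak*-continuous; any maximizer `μ*` for `w̃` is also a
maximizer for `w̄`, and `μ*({x : w̄(x) ≠ w̃(x)}) = 0`. -/
theorem rc_modification_same_value (a b : ℝ) (hab : a ≤ b)
    (wt : (Set.Icc a b) → ℝ) (hwt_mono : Monotone wt) (hwt_bdd : BddAbove (Set.range wt))
    (u : ℝ → ℝ) (hu_mono : StrictMono u) (hu_cont : Continuous u)
    (C : ProbabilityMeasure (Set.Icc a b) → ℝ) (hC_cont : Continuous C) :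
    ((⨆ μ : ProbabilityMeasure (Set.Icc a b),
        ((∫ x, u (rcModification wt x) ∂(μ : Measure (Set.Icc a b))) - C μ)) =
      ⨆ μ : ProbabilityMeasure (Set.Icc a b),
        ((∫ x, u (wt x) ∂(μ : Measure (Set.Icc a b))) - C μ)) ∧
    (∀ μstar : ProbabilityMeasure (Set.Icc a b),
      (∀ ν : ProbabilityMeasure (Set.Icc a b),
        (∫ x, u (wt x) ∂(ν : Measure (Set.Icc a b))) - C ν ≤
          (∫ x, u (wt x) ∂(μstar : Measure (Set.Icc a b))) - C μstar) →
      ((∀ ν : ProbabilityMeasure (Set.Icc a b),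
        (∫ x, u (rcModification wt x) ∂(ν : Measure (Set.Icc a b))) - C ν ≤
          (∫ x, u (rcModification wt x) ∂(μstar : Measure (Set.Icc a b))) - C μstar) ∧
        (μstar : Measure (Set.Icc a b)) {x | rcModification wt x ≠ wt x} = 0)) := by
  have hu := hu_mono.monotone
  have hle : ∀ μ : ProbabilityMeasure (Set.Icc a b),
      (∫ x, u (wt x) ∂(μ : Measure (Set.Icc a b))) - C μ ≤
      (∫ x, u (rcModification wt x) ∂(μ : Measure (Set.Icc a b))) - C μ := fun μ =>
    sub_le_sub_right (integral_mono (rc_aux_int hab (hu.comp hwt_mono) μ)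
      (rc_aux_int hab (hu.comp (rc_aux_mono hab hwt_mono)) μ)
      (fun x => hu (rc_aux_ge hwt_mono x))) _
  have key := rc_aux_key hab hwt_mono hu hC_cont
  refine ⟨?_, ?_⟩
  · have : Nonempty (ProbabilityMeasure (Set.Icc a b)) :=
      ⟨⟨Measure.dirac ⟨a, le_rfl, hab⟩, inferInstance⟩⟩
    by_cases hb : BddAbove (Set.range fun μ : ProbabilityMeasure (Set.Icc a b) =>
        (∫ x, u (wt x) ∂(μ : Measure (Set.Icc a b))) - C μ)
    · have hb2 : BddAbove (Set.range fun μ : ProbabilityMeasure (Set.Icc a b) =>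
          (∫ x, u (rcModification wt x) ∂(μ : Measure (Set.Icc a b))) - C μ) := by
        obtain ⟨K, hK⟩ := hb
        refine ⟨K, ?_⟩
        rintro _ ⟨μ, rfl⟩
        exact key K (fun ν => hK ⟨ν, rfl⟩) μ
      apply le_antisymm
      · exact ciSup_le fun μ => key _ (fun ν => le_ciSup hb ν) μ
      · exact ciSup_mono hb2 hle
    · rw [Real.iSup_of_not_bddAbove hb, Real.iSup_of_not_bddAbove]
      rintro ⟨K, hK⟩
      refine hb ⟨K, ?_⟩
      rintro _ ⟨μ, rfl⟩
      exact (hle μ).trans (hK ⟨μ, rfl⟩)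
  · intro μs hμ
    have hk := key _ hμ
    refine ⟨fun ν => (hk ν).trans (hle μs), ?_⟩
    have i1 := rc_aux_int hab (hu.comp (rc_aux_mono hab hwt_mono)) μs
    have i2 := rc_aux_int hab (hu.comp hwt_mono) μs
    have h0 : ∫ x, ((u ∘ rcModification wt) x - (u ∘ wt) x) ∂(μs : Measure (Set.Icc a b)) = 0 := by
      rw [integral_sub i1 i2]
      have h1 := hk μs
      have h2 := hle μs
      simp only [Function.comp_apply]
      linarith
    replace h0 := (integral_eq_zero_iff_of_nonneg
      (fun x => sub_nonneg.2 (hu (rc_aux_ge hwt_mono x))) (i1.sub i2)).1 h0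
    have h3 : ∀ᵐ x ∂(μs : Measure (Set.Icc a b)), rcModification wt x = wt x := by
      filter_upwards [h0] with x hx
      exact hu_mono.injective (sub_eq_zero.1 hx)
    exact h3
end

section
/- Let Θ = [θ̲, θ̄] ⊂ ℝ. Let V : Θ → ℝ, let V̂ : Θ × Θ → ℝ, and let D : Θ × Θ → ℝ be such that: (i) for every θ̂ ∈ Θ, the map t ↦ D(t, θ̂) is integrable on Θ and V̂(θ, θ̂) = V̂(θ̂, θ̂) + ∫_{θ̂}^{θ} D(t, θ̂) dt for all θ; (ii) V̂(θ, θ) = V(θ) for all θ; (iii) t ↦ D(t, t) is integrable and V(θ) = V(θ̲) + ∫_{θ̲}^{θ} D(t, t) dt for all θ. Then the truthtelling condition [V(θ) ≥ V̂(θ, θ̂) for all θ, θ̂ ∈ Θ] holds if and only if the generalized monotonicity condition [∫_{θ̂}^{θ} (D(t, t) − D(t, θ̂)) dt ≥ 0 for all θ, θ̂ ∈ Θ] holds. -/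
open MeasureTheory intervalIntegral

/-- Given the envelope condition, truthtelling is equivalent to
generalized monotonicity.  Here `V θ` is the on-path value of type `θ`,
`Vhat θ θhat` is the value to true type `θ` of reporting `θhat`, and
`D t θhat` is the marginal information rent `−∂C(t, μ_{t,θhat})/∂θ`. -/
theorem truthtelling_iff_generalized_monotonicity
    (θlo θhi : ℝ) (hθ : θlo ≤ θhi)
    (V : ℝ → ℝ) (Vhat D : ℝ → ℝ → ℝ)
    -- (i) integrability and the fundamental-theorem representation of Vhat
    (hDint : ∀ θhat ∈ Set.Icc θlo θhi, IntegrableOn (fun t => D t θhat) (Set.Icc θlo θhi))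
    (hVhat : ∀ θhat ∈ Set.Icc θlo θhi, ∀ θ ∈ Set.Icc θlo θhi,
      Vhat θ θhat = Vhat θhat θhat + ∫ t in θhat..θ, D t θhat)
    -- (ii) on-path value
    (hdiag : ∀ θ ∈ Set.Icc θlo θhi, Vhat θ θ = V θ)
    -- (iii) envelope condition
    (hDdiag : IntegrableOn (fun t => D t t) (Set.Icc θlo θhi))
    (henv : ∀ θ ∈ Set.Icc θlo θhi, V θ = V θlo + ∫ t in θlo..θ, D t t) :
    (∀ θ ∈ Set.Icc θlo θhi, ∀ θhat ∈ Set.Icc θlo θhi, V θ ≥ Vhat θ θhat) ↔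
      (∀ θ ∈ Set.Icc θlo θhi, ∀ θhat ∈ Set.Icc θlo θhi,
        0 ≤ ∫ t in θhat..θ, (D t t - D t θhat)) := by
  have key : ∀ f : ℝ → ℝ, IntegrableOn f (Set.Icc θlo θhi) → ∀ a ∈ Set.Icc θlo θhi,
      ∀ b ∈ Set.Icc θlo θhi, IntervalIntegrable f volume a b := by
    intro f hf a ha b hb
    exact (hf.mono_set (Set.uIcc_subset_Icc ha hb)).intervalIntegrable
  have hlo : θlo ∈ Set.Icc θlo θhi := ⟨le_refl _, hθ⟩
  have main : ∀ θ ∈ Set.Icc θlo θhi, ∀ θhat ∈ Set.Icc θlo θhi,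
      ∫ t in θhat..θ, (D t t - D t θhat) = V θ - Vhat θ θhat := by
    intro θ h1 θhat h2
    rw [intervalIntegral.integral_sub (key _ hDdiag _ h2 _ h1)
      (key _ (hDint θhat h2) _ h2 _ h1), hVhat θhat h2 θ h1, hdiag θhat h2]
    have h3 := intervalIntegral.integral_add_adjacent_intervals
      (key _ hDdiag _ hlo _ h2) (key _ hDdiag _ h2 _ h1)
    have h4 := henv θ h1
    have h5 := henv θhat h2
    linarith
  constructor
  · intro h θ h1 θhat h2
    rw [main θ h1 θhat h2]
    linarith [h θ h1 θhat h2]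
  · intro h θ h1 θhat h2
    have h3 := h θ h1 θhat h2
    rw [main θ h1 θhat h2] at h3
    linarith
end

section
/- Let X = [a, b] ⊂ ℝ with a < b, let z : X → ℝ be strictly increasing and continuous, let K : ℝ → ℝ be strictly increasing, and let c > 0. Let w : X → ℝ be a two-step wage: w(x) = w̲ for x < b and w(b) = w̄ with w̄ ≥ w̲. For any Borel probability measure μ on X, define μ' = μ({b})·δ_b + μ([a, b))·δ_a. Then ∫ w dμ' = ∫ w dμ and ∫ w dμ' − c·K( ∫ z dμ' ) ≥ ∫ w dμ − c·K( ∫ z dμ ), with strict inequality whenever μ((a, b)) > 0. Consequently, every maximizer of μ ↦ ∫ w dμ − c·K(∫ z dμ) has support contained in {a, b}. -/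
open MeasureTheory

theorem aux_core (a b : ℝ) (hab : a < b) (z : ℝ → ℝ)
    (hz_mono : StrictMonoOn z (Set.Icc a b))
    (hz_cont : ContinuousOn z (Set.Icc a b))
    (K : ℝ → ℝ) (hK : StrictMono K) (c : ℝ) (hc : 0 < c)
    (wlow whigh : ℝ)
    (w : ℝ → ℝ) (hwdef : ∀ x, w x = if x < b then wlow else whigh)
    (μ : Measure ℝ) (hμ : IsProbabilityMeasure μ) (hsupp : μ (Set.Icc a b)ᶜ = 0)
    (μ' : Measure ℝ)
    (hμ' : μ' = (μ {b}) • Measure.dirac b + (μ (Set.Ico a b)) • Measure.dirac a) :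
    IsProbabilityMeasure μ' ∧ μ' (Set.Icc a b)ᶜ = 0 ∧
    (∫ x, w x ∂μ' = ∫ x, w x ∂μ) ∧
     ((∫ x, w x ∂μ) - c * K (∫ x, z x ∂μ) ≤ (∫ x, w x ∂μ') - c * K (∫ x, z x ∂μ')) ∧
     (0 < μ (Set.Ioo a b) →
       (∫ x, w x ∂μ) - c * K (∫ x, z x ∂μ) < (∫ x, w x ∂μ') - c * K (∫ x, z x ∂μ')) := by
  have hae : ∀ᵐ x ∂μ, x ∈ Set.Icc a b := by
    rw [ae_iff]; exact hsupp
  have hone : μ {b} + μ (Set.Ico a b) = 1 := by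
    rw [← measure_union (by simp) measurableSet_Ico, Set.union_comm, Set.Ico_union_right hab.le]
    exact (prob_compl_eq_zero_iff measurableSet_Icc).1 hsupp
  have hgi : ∀ f : ℝ → ℝ, Integrable (fun x => Set.indicator {b} (fun _ => f b) x
      + Set.indicator (Set.Ico a b) (fun _ => f a) x) μ := fun f =>
    ((integrable_const _).indicator (measurableSet_singleton b)).add
      ((integrable_const _).indicator measurableSet_Ico)
  have hint : ∀ f : ℝ → ℝ, ∫ x, f x ∂μ' = ∫ x, (Set.indicator {b} (fun _ => f b) x
      + Set.indicator (Set.Ico a b) (fun _ => f a) x) ∂μ := by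
    intro f
    rw [integral_add ((integrable_const _).indicator (measurableSet_singleton b))
      ((integrable_const _).indicator measurableSet_Ico),
      integral_indicator_const _ (measurableSet_singleton b),
      integral_indicator_const _ measurableSet_Ico, hμ', integral_add_measure, integral_smul_measure,
      integral_smul_measure, integral_dirac, integral_dirac]
    · rfl
    · exact (integrable_dirac (by simp)).smul_measure (measure_ne_top _ _)
    · exact (integrable_dirac (by simp)).smul_measure (measure_ne_top _ _)
  have hw : ∫ x, w x ∂μ' = ∫ x, w x ∂μ := by
    rw [hint]
    apply integral_congr_ae
    filter_upwards [hae] with x hx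
    rcases hx.2.lt_or_eq with h | h
    · simp [hwdef, hx.1, h, h.ne, hab]
    · simp [hwdef, h]
  have hzi : Integrable z μ := by
    have := hz_cont.integrableOn_compact (μ := μ) isCompact_Icc
    rwa [IntegrableOn, Measure.restrict_eq_self_of_ae_mem hae] at this
  have hdle : 0 ≤ᵐ[μ] fun x => z x - (Set.indicator {b} (fun _ => z b) x
      + Set.indicator (Set.Ico a b) (fun _ => z a) x) := by
    filter_upwards [hae] with x hx
    rcases hx.2.lt_or_eq with h | h
    · have := hz_mono.monotoneOn (Set.left_mem_Icc.2 hab.le) hx hx.1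
      simpa [hx.1, h, h.ne] using this
    · simp [h]
  have hdi := hzi.sub (hgi z)
  have hsub := integral_sub hzi (hgi z)
  rw [← hint z] at hsub
  have hzle : ∫ x, z x ∂μ' ≤ ∫ x, z x ∂μ := by
    have := integral_nonneg_of_ae hdle
    linarith
  refine ⟨⟨?_⟩, ?_, hw, ?_, ?_⟩
  · rw [hμ']; simpa using hone
  · rw [hμ']; simp [hab.le]
  · rw [hw]
    have := mul_le_mul_of_nonneg_left (hK.monotone hzle) hc.le
    linarith
  · intro hpos
    have hlt : ∫ x, z x ∂μ' < ∫ x, z x ∂μ := by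
      have : 0 < ∫ x, (z x - (Set.indicator {b} (fun _ => z b) x
          + Set.indicator (Set.Ico a b) (fun _ => z a) x)) ∂μ := by
        rw [integral_pos_iff_support_of_nonneg_ae hdle hdi]
        refine hpos.trans_le (measure_mono ?_)
        intro x hx
        have := hz_mono (Set.left_mem_Icc.2 hab.le) (Set.Ioo_subset_Icc_self hx) hx.1
        simp [hx.1.le, hx.2, hx.2.ne, sub_eq_zero, this.ne']
      linarith
    rw [hw]
    have := mul_lt_mul_of_pos_left (hK hlt) hc
    linarith

/-- Off-path support argument for a two-step wage.  With `z` strictly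
increasing and continuous on `[a,b]`, `K` strictly increasing, `c > 0`, and the
two-step wage `w(x) = w̲` for `x < b`, `w(b) = w̄ ≥ w̲`, moving all mass of a
probability measure `μ` supported on `[a,b]` onto `{a, b}` via
`μ' = μ({b})·δ_b + μ([a,b))·δ_a` preserves the expected wage and weakly (strictly,
if `μ((a,b)) > 0`) increases `∫ w dμ − c·K(∫ z dμ)`; hence every maximizer is
supported on `{a, b}`. -/
theorem two_step_wage_binary_support (a b : ℝ) (hab : a < b) (z : ℝ → ℝ)
    (hz_mono : StrictMonoOn z (Set.Icc a b))
    (hz_cont : ContinuousOn z (Set.Icc a b))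
    (K : ℝ → ℝ) (hK : StrictMono K) (c : ℝ) (hc : 0 < c)
    (wlow whigh : ℝ) (hwage : wlow ≤ whigh)
    (w : ℝ → ℝ) (hwdef : ∀ x, w x = if x < b then wlow else whigh)
    (μ : Measure ℝ) (hμ : IsProbabilityMeasure μ) (hsupp : μ (Set.Icc a b)ᶜ = 0) :
    let μ' : Measure ℝ := (μ {b}) • Measure.dirac b + (μ (Set.Ico a b)) • Measure.dirac a
    ((∫ x, w x ∂μ' = ∫ x, w x ∂μ) ∧
     ((∫ x, w x ∂μ) - c * K (∫ x, z x ∂μ) ≤ (∫ x, w x ∂μ') - c * K (∫ x, z x ∂μ')) ∧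
     (0 < μ (Set.Ioo a b) →
       (∫ x, w x ∂μ) - c * K (∫ x, z x ∂μ) < (∫ x, w x ∂μ') - c * K (∫ x, z x ∂μ')) ∧
     (∀ ν : Measure ℝ, IsProbabilityMeasure ν → ν (Set.Icc a b)ᶜ = 0 →
       (∀ ν'' : Measure ℝ, IsProbabilityMeasure ν'' → ν'' (Set.Icc a b)ᶜ = 0 →
         (∫ x, w x ∂ν'') - c * K (∫ x, z x ∂ν'') ≤ (∫ x, w x ∂ν) - c * K (∫ x, z x ∂ν)) →
       ν ({a, b} : Set ℝ)ᶜ = 0)) := by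
  intro μ'
  obtain ⟨-, -, h1, h2, h3⟩ := aux_core a b hab z hz_mono hz_cont K hK c hc wlow whigh w hwdef
    μ hμ hsupp μ' rfl
  refine ⟨h1, h2, h3, ?_⟩
  intro ν hν hνs hmax
  obtain ⟨p, q, -, -, h⟩ := aux_core a b hab z hz_mono hz_cont K hK c hc wlow whigh w hwdef
    ν hν hνs _ rfl
  have h0 : ν (Set.Ioo a b) = 0 := by
    by_contra hne
    exact absurd (h (pos_iff_ne_zero.2 hne)) (not_lt.2 (hmax _ p q))
  refine measure_mono_null (t := (Set.Icc a b)ᶜ ∪ Set.Ioo a b) ?_ (measure_union_null hνs h0)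
  intro x hx
  simp only [Set.mem_compl_iff, Set.mem_insert_iff, Set.mem_singleton_iff, not_or] at hx
  by_cases hm : x ∈ Set.Icc a b
  · exact Or.inr ⟨lt_of_le_of_ne hm.1 (Ne.symm hx.1), lt_of_le_of_ne hm.2 hx.2⟩
  · exact Or.inl hm
end
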